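/- arXiv:2510.06521 — 3 statements merged into one kernel-verified Lean document; each statement's English description precedes it below -/
import Mathlib

section
/- Let k ≥ 1. In the ring of formal power series ℚ[[x]], one has Σ_{n≥k} (Σ_{π ∈ P_{n,k}} srec(π)) x^n = x^k · ∏_{j=1}^{k} (1 − j·x)^{−1} · ( Σ_{a=1}^{k} a(a−1)/2 + x · Σ_{i=1}^{k−1} ((k−i)·i·(i+1)/2) · (1 − i·x)^{−1} ), where each factor being inverted has constant term 1 and hence is a unit of ℚ[[x]]. -/
open Finset PowerSeries

/-- Restricted growth condition (canonical sequential form of a set partition):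
each entry is positive and at most one more than the maximum of the preceding entries
(so the first entry is `1`). -/
def IsRGW {n : ℕ} (π : Fin n → ℕ) : Prop :=
  ∀ i : Fin n, 1 ≤ π i ∧ π i ≤ (Finset.univ.filter (fun j => j < i)).sup π + 1

instance {n : ℕ} (π : Fin n → ℕ) : Decidable (IsRGW π) := by
  unfold IsRGW; infer_instance

/-- `Pnk n k` : the canonical sequential forms of set partitions of `[n]` with exactly
`k` blocks (restricted growth words of length `n` with maximum value `k`);
every such word has entries `≤ n`, so they are all captured as images of
functions `Fin n → Fin (n+1)`. -/
def Pnk (n k : ℕ) : Finset (Fin n → ℕ) :=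
  ((Finset.univ : Finset (Fin n → Fin (n+1))).filter
      (fun π => IsRGW (fun i => (π i : ℕ)) ∧ Finset.univ.sup (fun i => (π i : ℕ)) = k)).image
    (fun π i => (π i : ℕ))

/-- `Pall n` : the canonical sequential forms of all set partitions of `[n]`. -/
def Pall (n : ℕ) : Finset (Fin n → ℕ) :=
  ((Finset.univ : Finset (Fin n → Fin (n+1))).filter
      (fun π => IsRGW (fun i => (π i : ℕ)))).image (fun π i => (π i : ℕ))

/-- `sreca π a` : the sum of the entries of `π` strictly preceding the position of the
first occurrence of the (record) value `a`: an index `i` precedes that position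
iff no `j ≤ i` satisfies `π j = a`. -/
def sreca {n : ℕ} (π : Fin n → ℕ) (a : ℕ) : ℕ :=
  ∑ i ∈ Finset.univ.filter (fun i : Fin n => ∀ j, j ≤ i → π j ≠ a), π i

/-- `srec π` : the sum of `sreca π a` over all record values `a` of `π`
(for a restricted growth word the record values are exactly `1, …, max π`). -/
def srec {n : ℕ} (π : Fin n → ℕ) : ℕ :=
  ∑ a ∈ Finset.Icc 1 (Finset.univ.sup π), sreca π a

/-- Stirling numbers of the second kind `S_{n,k}`. -/
def stirling2 : ℕ → ℕ → ℕ
  | 0, 0 => 1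
  | 0, _ + 1 => 0
  | _ + 1, 0 => 0
  | n + 1, k + 1 => stirling2 n k + (k + 1) * stirling2 n (k + 1)

/-- Bell numbers `B_n`. -/
def bell (n : ℕ) : ℕ := ∑ k ∈ Finset.range (n + 1), stirling2 n k

/-- The formal power series `exp(cx) = Σ_{n≥0} c^n x^n / n!` in `ℚ[[x]]`. -/
noncomputable def expc (c : ℚ) : PowerSeries ℚ :=
  PowerSeries.mk fun n => c ^ n / n.factorial

/-- The formal exponential `exp(f) = Σ_{m≥0} f^m/m!` of a power series `f` with zero
constant term (then `coeff n (f^m) = 0` for `m > n`, so the truncated sum below is the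
full sum). In particular `psExp (expc 1 - 1)` is `exp(exp(x) - 1)`. -/
noncomputable def psExp (f : PowerSeries ℚ) : PowerSeries ℚ :=
  PowerSeries.mk fun n =>
    ∑ m ∈ Finset.range (n + 1), (PowerSeries.coeff n (f ^ m)) / m.factorial

theorem rgw_le {n : ℕ} {π : Fin n → ℕ} (h : IsRGW π) (m : ℕ) :
    ∀ i : Fin n, (i : ℕ) = m → π i ≤ m + 1 := by
  induction m using Nat.strong_induction_on with
  | _ m ih =>
    intro i hi
    refine (h i).2.trans ?_
    gcongr
    refine Finset.sup_le ?_
    intro j hj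
    have hj' : (j : ℕ) < m := by
      have := (Finset.mem_filter.1 hj).2
      rw [← hi]; exact this
    have := ih j hj' j rfl
    omega

theorem mem_Pnk {n k : ℕ} (π : Fin n → ℕ) :
    π ∈ Pnk n k ↔ IsRGW π ∧ Finset.univ.sup π = k := by
  unfold Pnk
  simp only [Finset.mem_image, Finset.mem_filter, Finset.mem_univ, true_and]
  constructor
  · rintro ⟨ρ, h, rfl⟩
    exact h
  · intro h
    refine ⟨fun i => ⟨π i, ?_⟩, h, rfl⟩
    have := rgw_le h.1 i i rfl
    have := i.2
    omega

theorem rgw_exists {n : ℕ} {π : Fin n → ℕ} (h : IsRGW π) {a : ℕ} (ha : 1 ≤ a)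
    (ha' : a ≤ Finset.univ.sup π) : ∃ j, π j = a := by
  by_contra! hne
  have key : ∀ m : ℕ, ∀ i : Fin n, (i : ℕ) = m → π i < a := by
    intro m
    induction m using Nat.strong_induction_on with
    | _ m ih =>
      intro i hi
      have h1 : (Finset.univ.filter (fun j => j < i)).sup π < a := by
        rw [Finset.sup_lt_iff (by exact ha)]
        intro j hj
        have hj' : (j : ℕ) < m := by
          have := (Finset.mem_filter.1 hj).2
          rw [← hi]; exact this
        exact ih j hj' j rfl
      have := (h i).2
      have := hne i
      omega
  have : Finset.univ.sup π < a := by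
    rw [Finset.sup_lt_iff (by exact ha)]
    intro j _
    exact key j j rfl
  omega

abbrev sn {n : ℕ} (σ : Fin n → ℕ) (c : ℕ) : Fin (n + 1) → ℕ := Fin.snoc (α := fun _ => ℕ) σ c

theorem sup_sn {n : ℕ} (σ : Fin n → ℕ) (c : ℕ) :
    Finset.univ.sup (sn σ c) = max (Finset.univ.sup σ) c := by
  apply eq_of_forall_ge_iff
  intro b
  simp [Finset.sup_le_iff, Fin.forall_fin_succ', sn]

theorem rgw_sn {n : ℕ} (σ : Fin n → ℕ) (c : ℕ) :
    IsRGW (sn σ c) ↔ IsRGW σ ∧ 1 ≤ c ∧ c ≤ Finset.univ.sup σ + 1 := by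
  have h1 : ∀ i : Fin n, (Finset.univ.filter (fun j => j < i.castSucc)).sup (sn σ c) =
      (Finset.univ.filter (fun j => j < i)).sup σ := by
    intro i
    apply eq_of_forall_ge_iff
    intro b
    have : ¬ (Fin.last n < i.castSucc) := by simp [Fin.le_last]
    simp [Finset.sup_le_iff, Fin.forall_fin_succ', sn, this]
  have h2 : (Finset.univ.filter (fun j => j < Fin.last n)).sup (sn σ c) =
      Finset.univ.sup σ := by
    apply eq_of_forall_ge_iff
    intro b
    simp [Finset.sup_le_iff, Fin.forall_fin_succ', sn, Fin.castSucc_lt_last]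
  unfold IsRGW
  rw [Fin.forall_fin_succ']
  simp only [h1, h2]
  simp [sn]

theorem sreca_sn {n : ℕ} (σ : Fin n → ℕ) (c a : ℕ) :
    sreca (sn σ c) a = sreca σ a + if (∀ j, σ j ≠ a) ∧ c ≠ a then c else 0 := by
  unfold sreca
  rw [Finset.sum_filter, Finset.sum_filter, Fin.sum_univ_castSucc]
  have h1 : ∀ i : Fin n, (∀ j, j ≤ i.castSucc → sn σ c j ≠ a) ↔ (∀ j, j ≤ i → σ j ≠ a) := by
    intro i
    have : ¬ (Fin.last n ≤ i.castSucc) := by simp [Fin.castSucc_lt_last]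
    simp [Fin.forall_fin_succ', sn, this]
  have h2 : (∀ j, j ≤ Fin.last n → sn σ c j ≠ a) ↔ (∀ j, σ j ≠ a) ∧ c ≠ a := by
    simp [Fin.forall_fin_succ', sn, Fin.le_last]
  simp only [h1, h2]
  simp [sn]

theorem srec_sn_old {n : ℕ} {σ : Fin n → ℕ} (h : IsRGW σ) {c : ℕ}
    (hc : c ≤ Finset.univ.sup σ) : srec (sn σ c) = srec σ := by
  unfold srec
  rw [sup_sn, max_eq_left hc]
  refine Finset.sum_congr rfl ?_
  intro a ha
  rw [Finset.mem_Icc] at ha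
  obtain ⟨j, hj⟩ := rgw_exists h ha.1 ha.2
  rw [sreca_sn, if_neg, add_zero]
  intro h'
  exact h'.1 j hj

theorem srec_sn_new {n : ℕ} {σ : Fin n → ℕ} (h : IsRGW σ) :
    srec (sn σ (Finset.univ.sup σ + 1)) = srec σ + ∑ i, σ i := by
  unfold srec
  rw [sup_sn, max_eq_right (by omega), Finset.sum_Icc_succ_top (by omega)]
  congr 1
  · refine Finset.sum_congr rfl ?_
    intro a ha
    rw [Finset.mem_Icc] at ha
    obtain ⟨j, hj⟩ := rgw_exists h ha.1 ha.2
    rw [sreca_sn, if_neg, add_zero]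
    intro h'
    exact h'.1 j hj
  · rw [sreca_sn, if_neg (by simp), add_zero]
    unfold sreca
    rw [Finset.filter_true_of_mem]
    intro i _ j _ hj
    have := Finset.le_sup (f := σ) (Finset.mem_univ j)
    omega

theorem sum_sn {n : ℕ} (σ : Fin n → ℕ) (c : ℕ) : ∑ i, sn σ c i = ∑ i, σ i + c := by
  rw [Fin.sum_univ_castSucc]
  simp [sn]

theorem sn_inj {n : ℕ} {σ τ : Fin n → ℕ} {c d : ℕ} (h : sn σ c = sn τ d) : σ = τ ∧ c = d := by
  constructor
  · funext i
    simpa [sn] using congrFun h i.castSucc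
  · simpa [sn] using congrFun h (Fin.last n)

theorem Pnk_succ (n k : ℕ) : Pnk (n + 1) (k + 1) =
    (Pnk n (k + 1) ×ˢ Finset.Icc 1 (k + 1)).image (fun p => sn p.1 p.2) ∪
      (Pnk n k).image (fun σ => sn σ (k + 1)) := by
  ext π
  simp only [Finset.mem_union, Finset.mem_image, Finset.mem_product, mem_Pnk, Prod.exists,
    Finset.mem_Icc]
  constructor
  · intro ⟨h1, h2⟩
    have hπ : π = sn (fun i => π i.castSucc) (π (Fin.last n)) := by
      exact (Fin.snoc_init_self (α := fun _ => ℕ) π).symm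
    generalize (fun i : Fin n => π i.castSucc) = σ at hπ
    generalize π (Fin.last n) = c at hπ
    subst hπ
    rw [rgw_sn] at h1
    rw [sup_sn] at h2
    by_cases hs : Finset.univ.sup σ = k + 1
    · left
      exact ⟨σ, c, ⟨⟨h1.1, hs⟩, by omega⟩, rfl⟩
    · right
      have hc : c = k + 1 := by omega
      exact ⟨σ, ⟨h1.1, by omega⟩, by rw [hc]⟩
  · rintro (⟨σ, c, ⟨⟨h1, h2⟩, h3⟩, rfl⟩ | ⟨σ, ⟨h1, h2⟩, rfl⟩)
    · rw [rgw_sn, sup_sn]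
      exact ⟨⟨h1, by omega⟩, by omega⟩
    · rw [rgw_sn, sup_sn]
      exact ⟨⟨h1, by omega⟩, by omega⟩

theorem sum_Pnk_succ (n k : ℕ) (f : (Fin (n + 1) → ℕ) → ℚ) :
    ∑ π ∈ Pnk (n + 1) (k + 1), f π =
      ∑ σ ∈ Pnk n (k + 1), ∑ c ∈ Finset.Icc 1 (k + 1), f (sn σ c) +
        ∑ σ ∈ Pnk n k, f (sn σ (k + 1)) := by
  rw [Pnk_succ, Finset.sum_union, Finset.sum_image, Finset.sum_image, Finset.sum_product]
  · intro σ _ τ _ h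
    exact (sn_inj h).1
  · intro p _ q _ h
    exact Prod.ext (sn_inj h).1 (sn_inj h).2
  · rw [Finset.disjoint_left]
    intro π h1 h2
    simp only [Finset.mem_image, Finset.mem_product, mem_Pnk, Prod.exists,
      Finset.mem_Icc] at h1 h2
    obtain ⟨σ, c, ⟨⟨_, h3⟩, _⟩, rfl⟩ := h1
    obtain ⟨τ, ⟨_, h4⟩, h5⟩ := h2
    have := (sn_inj h5).1
    subst this
    omega

theorem Pnk_zero_succ (k : ℕ) : Pnk 0 (k + 1) = ∅ := by
  ext π
  simp [mem_Pnk]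

/-- Counting generating function. -/
noncomputable def gN (k : ℕ) : PowerSeries ℚ := PowerSeries.mk fun n => ∑ _π ∈ Pnk n k, (1 : ℚ)
/-- Generating function of the total of entries. -/
noncomputable def gT (k : ℕ) : PowerSeries ℚ :=
  PowerSeries.mk fun n => ∑ π ∈ Pnk n k, ((∑ i, π i : ℕ) : ℚ)
/-- Generating function of `srec`. -/
noncomputable def gS (k : ℕ) : PowerSeries ℚ := PowerSeries.mk fun n => ∑ π ∈ Pnk n k, (srec π : ℚ)

theorem gauss (k : ℕ) : ∑ c ∈ Finset.Icc 1 k, (c : ℚ) = k * (k + 1) / 2 := by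
  induction k with
  | zero => simp
  | succ k ih => rw [Finset.sum_Icc_succ_top (by omega), ih]; push_cast; ring

theorem gN_succ (k : ℕ) :
    gN (k + 1) = PowerSeries.X * (((k + 1 : ℕ) : PowerSeries ℚ) * gN (k + 1) + gN k) := by
  ext n
  rw [← map_natCast (PowerSeries.C (R := ℚ))]
  cases n with
  | zero => simp [gN, Pnk_zero_succ]
  | succ n =>
    rw [PowerSeries.coeff_succ_X_mul]
    simp only [map_add, PowerSeries.coeff_C_mul, gN, PowerSeries.coeff_mk]
    rw [sum_Pnk_succ]
    simp
    ring

theorem gT_succ (k : ℕ) :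
    gT (k + 1) = PowerSeries.X * (((k + 1 : ℕ) : PowerSeries ℚ) * gT (k + 1) +
      PowerSeries.C (((k + 1 : ℕ) : ℚ) * (((k + 1 : ℕ) : ℚ) + 1) / 2) * gN (k + 1) + gT k +
      PowerSeries.C ((k + 1 : ℕ) : ℚ) * gN k) := by
  ext n
  rw [← map_natCast (PowerSeries.C (R := ℚ))]
  cases n with
  | zero => simp [gT, Pnk_zero_succ]
  | succ n =>
    rw [PowerSeries.coeff_succ_X_mul]
    simp only [map_add, PowerSeries.coeff_C_mul, gN, gT, PowerSeries.coeff_mk]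
    rw [sum_Pnk_succ]
    simp only [sum_sn, Nat.cast_add (∑ i, _) _, Finset.sum_add_distrib, gauss]
    simp only [Finset.sum_const, Nat.card_Icc, nsmul_eq_mul, Finset.mul_sum, add_tsub_cancel_right]
    ring

theorem gS_succ (k : ℕ) :
    gS (k + 1) = PowerSeries.X * (((k + 1 : ℕ) : PowerSeries ℚ) * gS (k + 1) + gS k + gT k) := by
  ext n
  rw [← map_natCast (PowerSeries.C (R := ℚ))]
  cases n with
  | zero => simp [gS, Pnk_zero_succ]
  | succ n =>
    rw [PowerSeries.coeff_succ_X_mul]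
    simp only [map_add, PowerSeries.coeff_C_mul, gS, gT, PowerSeries.coeff_mk]
    rw [sum_Pnk_succ]
    have h1 : ∑ σ ∈ Pnk n (k + 1), ∑ c ∈ Finset.Icc 1 (k + 1), (srec (sn σ c) : ℚ) =
        ∑ σ ∈ Pnk n (k + 1), ((k + 1 : ℕ) : ℚ) * (srec σ : ℚ) := by
      refine Finset.sum_congr rfl fun σ hσ => ?_
      rw [mem_Pnk] at hσ
      rw [Finset.sum_congr rfl (g := fun _ => (srec σ : ℚ))]
      · simp
      · intro c hc
        rw [Finset.mem_Icc] at hc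
        rw [srec_sn_old hσ.1 (by omega)]
    have h2 : ∑ σ ∈ Pnk n k, (srec (sn σ (k + 1)) : ℚ) =
        ∑ σ ∈ Pnk n k, ((srec σ : ℚ) + ((∑ i, σ i : ℕ) : ℚ)) := by
      refine Finset.sum_congr rfl fun σ hσ => ?_
      rw [mem_Pnk] at hσ
      have := srec_sn_new hσ.1
      rw [hσ.2] at this
      rw [this, Nat.cast_add]
    rw [h1, h2, Finset.sum_add_distrib, Finset.mul_sum]
    ring

theorem Pnk_zero_zero : Pnk 0 0 = {Fin.elim0} := by
  ext π
  have : π = Fin.elim0 := Subsingleton.elim _ _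
  simp [mem_Pnk, IsRGW, this]

theorem Pnk_succ_zero (n : ℕ) : Pnk (n + 1) 0 = ∅ := by
  ext π
  simp only [mem_Pnk, Finset.notMem_empty, iff_false]
  rintro ⟨h1, h2⟩
  have h3 := (h1 0).1
  have := Finset.le_sup (f := π) (Finset.mem_univ 0)
  omega

theorem gN_zero : gN 0 = 1 := by
  ext n
  cases n <;> simp [gN, Pnk_zero_zero, Pnk_succ_zero, PowerSeries.coeff_one]

theorem gT_zero : gT 0 = 0 := by
  ext n
  cases n <;> simp [gT, Pnk_zero_zero, Pnk_succ_zero]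

theorem gS_zero : gS 0 = 0 := by
  ext n
  cases n <;> simp [gS, Pnk_zero_zero, Pnk_succ_zero, srec]

/-- The inverse of `1 - jx`. -/
noncomputable def uu (j : ℕ) : PowerSeries ℚ :=
  Ring.inverse (1 - (j : PowerSeries ℚ) * PowerSeries.X)

theorem uu_mul (j : ℕ) : (1 - (j : PowerSeries ℚ) * PowerSeries.X) * uu j = 1 := by
  apply Ring.mul_inverse_cancel
  rw [PowerSeries.isUnit_iff_constantCoeff]
  simp

theorem solve_uu {j : ℕ} {A B : PowerSeries ℚ}
    (h : A = PowerSeries.X * ((j : PowerSeries ℚ) * A + B)) : A = PowerSeries.X * uu j * B := by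
  linear_combination (uu j) * h - A * uu_mul j

theorem gN_step (k : ℕ) : gN (k + 1) = PowerSeries.X * uu (k + 1) * gN k :=
  solve_uu (gN_succ k)

/-- The factor for `gT`. -/
noncomputable def GG (k : ℕ) : PowerSeries ℚ :=
  PowerSeries.C (∑ a ∈ Finset.Icc 1 k, (a : ℚ)) + PowerSeries.X *
    ∑ i ∈ Finset.Icc 1 k, PowerSeries.C ((i : ℚ) * ((i : ℚ) + 1) / 2) * uu i

/-- The factor for `gS`. -/
noncomputable def FF (k : ℕ) : PowerSeries ℚ :=
  PowerSeries.C (∑ a ∈ Finset.Icc 1 k, (a : ℚ) * ((a : ℚ) - 1) / 2) + PowerSeries.X *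
    ∑ i ∈ Finset.Icc 1 (k - 1),
      PowerSeries.C (((k : ℚ) - (i : ℚ)) * (i : ℚ) * ((i : ℚ) + 1) / 2) * uu i

theorem gN_eq (k : ℕ) : gN k = PowerSeries.X ^ k * ∏ j ∈ Finset.Icc 1 k, uu j := by
  induction k with
  | zero => simp [gN_zero]
  | succ k ih =>
    rw [gN_step, ih, Finset.prod_Icc_succ_top (by omega)]
    ring

theorem gT_eq (k : ℕ) : gT k = gN k * GG k := by
  induction k with
  | zero => simp [gT_zero, GG]
  | succ k ih =>
    have h := solve_uu (j := k + 1) (A := gT (k + 1)) (B := PowerSeries.C (((k + 1 : ℕ) : ℚ) *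
      (((k + 1 : ℕ) : ℚ) + 1) / 2) * gN (k + 1) + gT k + PowerSeries.C ((k + 1 : ℕ) : ℚ) * gN k)
      (by rw [← add_assoc, ← add_assoc]; exact gT_succ k)
    have hG : GG (k + 1) = GG k + PowerSeries.C ((k + 1 : ℕ) : ℚ) + PowerSeries.X *
        (PowerSeries.C (((k + 1 : ℕ) : ℚ) * (((k + 1 : ℕ) : ℚ) + 1) / 2) * uu (k + 1)) := by
      unfold GG
      rw [Finset.sum_Icc_succ_top (by omega), Finset.sum_Icc_succ_top (by omega), map_add]
      ring
    rw [h, hG, ih, gN_step]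
    ring

theorem FF_succ (k : ℕ) : FF (k + 1) = FF k + GG k := by
  unfold FF GG
  have h1 : ∑ i ∈ Finset.Icc 1 (k - 1),
      PowerSeries.C (((k : ℚ) - (i : ℚ)) * (i : ℚ) * ((i : ℚ) + 1) / 2) * uu i =
      ∑ i ∈ Finset.Icc 1 k,
      PowerSeries.C (((k : ℚ) - (i : ℚ)) * (i : ℚ) * ((i : ℚ) + 1) / 2) * uu i := by
    cases k with
    | zero => simp
    | succ k => rw [Finset.sum_Icc_succ_top (by omega)]; simp
  rw [h1, Finset.sum_Icc_succ_top (by omega), gauss, add_tsub_cancel_right]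
  have h2 : ∑ i ∈ Finset.Icc 1 k,
      PowerSeries.C ((((k + 1 : ℕ) : ℚ) - (i : ℚ)) * (i : ℚ) * ((i : ℚ) + 1) / 2) * uu i =
      ∑ i ∈ Finset.Icc 1 k,
      PowerSeries.C (((k : ℚ) - (i : ℚ)) * (i : ℚ) * ((i : ℚ) + 1) / 2) * uu i +
      ∑ i ∈ Finset.Icc 1 k, PowerSeries.C ((i : ℚ) * ((i : ℚ) + 1) / 2) * uu i := by
    rw [← Finset.sum_add_distrib]
    refine Finset.sum_congr rfl fun i _ => ?_
    rw [← add_mul, ← map_add]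
    congr 2
    push_cast
    ring
  have h3 : ((k + 1 : ℕ) : ℚ) * (((k + 1 : ℕ) : ℚ) - 1) / 2 = k * (k + 1) / 2 := by
    push_cast; ring
  rw [h2, h3, map_add]
  ring

theorem gS_eq (k : ℕ) : gS k = gN k * FF k := by
  induction k with
  | zero => simp [gS_zero, FF]
  | succ k ih =>
    have h := solve_uu (j := k + 1) (A := gS (k + 1)) (B := gS k + gT k)
      (by rw [← add_assoc]; exact gS_succ k)
    rw [h, FF_succ, ih, gT_eq, gN_step]
    ring

/-- For `k ≥ 1`, in `ℚ[[x]]`: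
`Σ_{n≥k} (Σ_{π ∈ P_{n,k}} srec(π)) x^n
  = x^k ∏_{j=1}^{k} (1 - jx)⁻¹ ( Σ_{a=1}^{k} a(a-1)/2
      + x Σ_{i=1}^{k-1} ((k-i)i(i+1)/2)(1 - ix)⁻¹ )`,
the inverses being `Ring.inverse` of the corresponding units. -/
theorem sum_elements_record_total_gf (k : ℕ) (hk : 1 ≤ k) :
    PowerSeries.mk (fun n => (∑ π ∈ Pnk n k, srec π : ℚ)) =
      (PowerSeries.X : PowerSeries ℚ) ^ k *
        (∏ j ∈ Finset.Icc 1 k, Ring.inverse (1 - (j : PowerSeries ℚ) * PowerSeries.X)) *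
        (PowerSeries.C (∑ a ∈ Finset.Icc 1 k, (a : ℚ) * ((a : ℚ) - 1) / 2) +
          PowerSeries.X *
            ∑ i ∈ Finset.Icc 1 (k - 1),
              PowerSeries.C (((k : ℚ) - (i : ℚ)) * (i : ℚ) * ((i : ℚ) + 1) / 2) *
                Ring.inverse (1 - (i : PowerSeries ℚ) * PowerSeries.X)) := by
  have h := gS_eq k
  rw [gN_eq] at h
  exact h
end

section
/- For every n ≥ 0, the total value of srec over all set partitions of [n] equals (1/3)B_{n+3} − (1/4)B_{n+2} − (n/2 + 13/12)B_{n+1} − (1/12 + n/2)B_n; equivalently, 12 · Σ_{π ∈ P_n} srec(π) = 4·B_{n+3} − 3·B_{n+2} − (6n + 13)·B_{n+1} − (6n + 1)·B_n. -/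
open Finset PowerSeries

/-- Append a letter to a word. -/
def appW {n : ℕ} (π : Fin n → ℕ) (x : ℕ) : Fin (n+1) → ℕ := Fin.snoc (α := fun _ => ℕ) π x

/-- Maximum of a word. -/
def mx {n : ℕ} (π : Fin n → ℕ) : ℕ := Finset.univ.sup π

lemma appW_castSucc {n : ℕ} (π : Fin n → ℕ) (x : ℕ) (i : Fin n) :
    appW π x i.castSucc = π i := by simp [appW]

lemma appW_last {n : ℕ} (π : Fin n → ℕ) (x : ℕ) : appW π x (Fin.last n) = x := by simp [appW]

lemma appW_init {n : ℕ} (π : Fin (n+1) → ℕ) :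
    appW (fun i : Fin n => π i.castSucc) (π (Fin.last n)) = π := by
  funext i
  refine Fin.lastCases ?_ (fun i => ?_) i
  · rw [appW_last]
  · rw [appW_castSucc]

lemma mx_appW {n : ℕ} (π : Fin n → ℕ) (x : ℕ) : mx (appW π x) = max (mx π) x := by
  apply le_antisymm
  · unfold mx
    apply Finset.sup_le
    intro i _
    refine Fin.lastCases ?_ (fun i => ?_) i
    · rw [appW_last]; exact le_max_right _ _
    · rw [appW_castSucc]
      exact le_trans (Finset.le_sup (f := π) (mem_univ i)) (le_max_left _ _)
  · apply max_le
    · apply Finset.sup_le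
      intro i _
      rw [← appW_castSucc π x i]
      exact Finset.le_sup (f := appW π x) (mem_univ _)
    · conv_lhs => rw [← appW_last π x]
      exact Finset.le_sup (f := appW π x) (mem_univ _)

lemma sup_lt_castSucc {n : ℕ} (π : Fin n → ℕ) (x : ℕ) (i : Fin n) :
    (Finset.univ.filter (fun j => j < i.castSucc)).sup (appW π x)
      = (Finset.univ.filter (fun j => j < i)).sup π := by
  apply le_antisymm
  · apply Finset.sup_le
    intro j hj
    have hj' : j < i.castSucc := by simpa using hj
    induction j using Fin.lastCases with
    | last => exact absurd hj' (not_lt.mpr (Fin.le_last _))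
    | cast j =>
      rw [appW_castSucc]
      exact Finset.le_sup (f := π) (by simpa using hj')
  · apply Finset.sup_le
    intro j hj
    rw [← appW_castSucc π x j]
    exact Finset.le_sup (f := appW π x) (by simpa using hj)

lemma sup_lt_last {n : ℕ} (π : Fin n → ℕ) (x : ℕ) :
    (Finset.univ.filter (fun j => j < Fin.last n)).sup (appW π x) = mx π := by
  apply le_antisymm
  · apply Finset.sup_le
    intro j hj
    have hj' : j < Fin.last n := by simpa using hj
    induction j using Fin.lastCases with
    | last => exact absurd hj' (lt_irrefl _)
    | cast j =>
      rw [appW_castSucc]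
      exact Finset.le_sup (f := π) (mem_univ j)
  · apply Finset.sup_le
    intro j _
    rw [← appW_castSucc π x j]
    exact Finset.le_sup (f := appW π x) (by simp [Fin.castSucc_lt_last])

lemma isRGW_appW {n : ℕ} (π : Fin n → ℕ) (x : ℕ) :
    IsRGW (appW π x) ↔ IsRGW π ∧ x ∈ Finset.Icc 1 (mx π + 1) := by
  unfold IsRGW
  rw [Fin.forall_fin_succ']
  simp only [appW_castSucc, appW_last, sup_lt_castSucc, sup_lt_last, Finset.mem_Icc]

lemma mx_le {n : ℕ} (π : Fin n → ℕ) (h : IsRGW π) : mx π ≤ n := by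
  induction n with
  | zero => simp [mx]
  | succ n ih =>
    rw [← appW_init π] at h ⊢
    rw [isRGW_appW, Finset.mem_Icc] at h
    have := ih _ h.1
    rw [mx_appW]
    omega

lemma exists_pos_of_le_mx {n : ℕ} (π : Fin n → ℕ) (h : IsRGW π) (a : ℕ) (ha : 1 ≤ a) (ha' : a ≤ mx π) :
    ∃ j, π j = a := by
  induction n with
  | zero => simp [mx] at ha'; omega
  | succ n ih =>
    rw [← appW_init π] at h ha'
    rw [isRGW_appW, Finset.mem_Icc] at h
    rw [mx_appW] at ha'
    by_cases hc : a ≤ mx (fun i : Fin n => π i.castSucc)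
    · obtain ⟨j, hj⟩ := ih _ h.1 hc
      exact ⟨_, hj⟩
    · refine ⟨Fin.last n, ?_⟩
      omega

lemma mem_Pall {n : ℕ} (π : Fin n → ℕ) : π ∈ Pall n ↔ IsRGW π := by
  unfold Pall
  simp only [Finset.mem_image, Finset.mem_filter, Finset.mem_univ, true_and]
  constructor
  · rintro ⟨ρ, h, rfl⟩
    exact h
  · intro h
    have hle : ∀ i, π i < n + 1 := fun i =>
      Nat.lt_succ_of_le (le_trans (Finset.le_sup (f := π) (mem_univ i)) (mx_le π h))
    exact ⟨fun i => ⟨π i, hle i⟩, h, rfl⟩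

lemma sum_Pall_succ (n : ℕ) (F : (Fin (n+1) → ℕ) → ℚ) :
    ∑ π ∈ Pall (n+1), F π = ∑ π ∈ Pall n, ∑ x ∈ Finset.Icc 1 (mx π + 1), F (appW π x) := by
  rw [Finset.sum_sigma']
  symm
  refine Finset.sum_bij' (fun p _ => appW p.1 p.2)
    (fun π _ => ⟨fun i : Fin n => π i.castSucc, π (Fin.last n)⟩) ?_ ?_ ?_ ?_ ?_
  · rintro ⟨π, x⟩ h
    rw [Finset.mem_sigma, mem_Pall] at h
    rw [mem_Pall, isRGW_appW]
    exact h
  · intro π h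
    rw [mem_Pall, ← appW_init π, isRGW_appW] at h
    rw [Finset.mem_sigma, mem_Pall]
    exact h
  · rintro ⟨π, x⟩ _
    simp [appW_castSucc, appW_last]
  · intro π _
    exact appW_init π
  · intros
    rfl

lemma sreca_eq {n : ℕ} (π : Fin n → ℕ) (a : ℕ) :
    sreca π a = ∑ i, if (∀ j, j ≤ i → π j ≠ a) then π i else 0 := by
  unfold sreca
  rw [Finset.sum_filter]

lemma sreca_appW {n : ℕ} (π : Fin n → ℕ) (x a : ℕ) :
    sreca (appW π x) a = sreca π a + if (∀ j, appW π x j ≠ a) then x else 0 := by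
  rw [sreca_eq, sreca_eq, Fin.sum_univ_castSucc, appW_last]
  congr 1
  · apply Finset.sum_congr rfl
    intro i _
    rw [appW_castSucc]
    congr 1
    apply propext
    constructor
    · intro h j hj
      have := h j.castSucc (by simpa using hj)
      rwa [appW_castSucc] at this
    · intro h j hj
      induction j using Fin.lastCases with
      | last => exact absurd hj (not_le.mpr (Fin.castSucc_lt_last i))
      | cast j =>
        rw [appW_castSucc]
        exact h j (by simpa using hj)
  · congr 1
    apply propext
    exact ⟨fun h j => h j (Fin.le_last j), fun h j _ => h j⟩

lemma sreca_appW_of_le {n : ℕ} (π : Fin n → ℕ) (h : IsRGW π) (x a : ℕ)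
    (ha : 1 ≤ a) (ha' : a ≤ mx π) : sreca (appW π x) a = sreca π a := by
  rw [sreca_appW, if_neg, add_zero]
  obtain ⟨j, hj⟩ := exists_pos_of_le_mx π h a ha ha'
  intro hh
  exact hh j.castSucc (by rw [appW_castSucc, hj])

lemma srec_appW_le {n : ℕ} (π : Fin n → ℕ) (h : IsRGW π) (x : ℕ) (hx : x ≤ mx π) :
    srec (appW π x) = srec π := by
  have h1 : Finset.univ.sup (appW π x) = mx π := by
    have := mx_appW π x
    rwa [max_eq_left hx] at this
  unfold srec
  rw [h1]
  apply Finset.sum_congr rfl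
  intro a ha
  rw [Finset.mem_Icc] at ha
  exact sreca_appW_of_le π h x a ha.1 ha.2

lemma srec_appW_top {n : ℕ} (π : Fin n → ℕ) (h : IsRGW π) :
    srec (appW π (mx π + 1)) = srec π + ∑ i, π i := by
  have h1 : Finset.univ.sup (appW π (mx π + 1)) = mx π + 1 := by
    have := mx_appW π (mx π + 1)
    rwa [max_eq_right (Nat.le_succ _)] at this
  unfold srec
  rw [h1, Finset.sum_Icc_succ_top (by omega)]
  congr 1
  · apply Finset.sum_congr rfl
    intro a ha
    rw [Finset.mem_Icc] at ha
    exact sreca_appW_of_le π h _ a ha.1 ha.2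
  · rw [sreca_appW, if_neg, add_zero, sreca_eq]
    · apply Finset.sum_congr rfl
      intro i _
      rw [if_pos]
      intro j _
      have : π j ≤ mx π := Finset.le_sup (f := π) (mem_univ j)
      omega
    · intro hh
      exact hh (Fin.last n) (appW_last _ _)

/-- weighted count -/
def Lf (n : ℕ) (f : ℕ → ℚ) : ℚ := ∑ π ∈ Pall n, f (mx π)
/-- weighted sum of entries -/
def Sf (n : ℕ) (f : ℕ → ℚ) : ℚ := ∑ π ∈ Pall n, ((∑ i, π i : ℕ) : ℚ) * f (mx π)
/-- weighted srec -/
def Rf (n : ℕ) (f : ℕ → ℚ) : ℚ := ∑ π ∈ Pall n, (srec π : ℚ) * f (mx π)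

/-- transfer operator -/
def Tf (f : ℕ → ℚ) : ℕ → ℚ := fun k => k * f k + f (k+1)

lemma Lf_succ (n : ℕ) (f : ℕ → ℚ) : Lf (n+1) f = Lf n (Tf f) := by
  unfold Lf
  rw [sum_Pall_succ]
  apply Finset.sum_congr rfl
  intro π _
  rw [Finset.sum_Icc_succ_top (by omega), mx_appW, max_eq_right (Nat.le_succ _),
    Finset.sum_congr rfl (g := fun _ => f (mx π))]
  · simp [Tf]
  · intro x hx
    rw [Finset.mem_Icc] at hx
    rw [mx_appW, max_eq_left hx.2]

lemma sum_appW {n : ℕ} (π : Fin n → ℕ) (x : ℕ) : ∑ i, appW π x i = ∑ i, π i + x := by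
  rw [Fin.sum_univ_castSucc, appW_last]
  simp only [appW_castSucc]

lemma sum_Icc_id (m : ℕ) : ∑ x ∈ Finset.Icc 1 m, (x : ℚ) = m * (m + 1) / 2 := by
  induction m with
  | zero => simp
  | succ m ih =>
    rw [Finset.sum_Icc_succ_top (by omega), ih]
    push_cast
    ring

lemma Sf_succ (n : ℕ) (f : ℕ → ℚ) : Sf (n+1) f = Sf n (Tf f)
    + Lf n (fun k => (k : ℚ) * (k+1) / 2 * f k + (k+1) * f (k+1)) := by
  unfold Sf Lf
  rw [sum_Pall_succ, ← Finset.sum_add_distrib]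
  apply Finset.sum_congr rfl
  intro π _
  rw [Finset.sum_Icc_succ_top (by omega), mx_appW, max_eq_right (Nat.le_succ _),
    Finset.sum_congr rfl (g := fun x : ℕ => ((∑ i, π i : ℕ) : ℚ) * f (mx π) + (x : ℚ) * f (mx π))]
  · rw [Finset.sum_add_distrib, ← Finset.sum_mul, ← Finset.sum_mul, sum_Icc_id, sum_appW]
    simp only [Finset.sum_const, Nat.card_Icc, nsmul_eq_mul, Tf, Nat.add_sub_cancel]
    push_cast
    ring
  · intro x hx
    rw [Finset.mem_Icc] at hx
    rw [mx_appW, max_eq_left hx.2, sum_appW]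
    push_cast
    ring

lemma Rf_succ (n : ℕ) (f : ℕ → ℚ) : Rf (n+1) f = Rf n (Tf f) + Sf n (fun k => f (k+1)) := by
  unfold Rf Sf
  rw [sum_Pall_succ, ← Finset.sum_add_distrib]
  apply Finset.sum_congr rfl
  intro π hπ
  rw [mem_Pall] at hπ
  rw [Finset.sum_Icc_succ_top (by omega), mx_appW, max_eq_right (Nat.le_succ _),
    srec_appW_top π hπ,
    Finset.sum_congr rfl (g := fun _ : ℕ => (srec π : ℚ) * f (mx π))]
  · simp only [Finset.sum_const, Nat.card_Icc, nsmul_eq_mul, Tf, Nat.add_sub_cancel]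
    push_cast
    ring
  · intro x hx
    rw [Finset.mem_Icc] at hx
    rw [mx_appW, max_eq_left hx.2, srec_appW_le π hπ x hx.2]

lemma Lf_add (n : ℕ) (f g : ℕ → ℚ) : Lf n (fun k => f k + g k) = Lf n f + Lf n g := by
  simp [Lf, Finset.sum_add_distrib]

lemma Lf_smul (n : ℕ) (c : ℚ) (f : ℕ → ℚ) : Lf n (fun k => c * f k) = c * Lf n f := by
  simp [Lf, Finset.mul_sum]

lemma Pall_zero : Pall 0 = {fun i => i.elim0} := by
  ext π
  rw [mem_Pall, Finset.mem_singleton]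
  constructor
  · intro _
    exact Subsingleton.elim _ _
  · intro _ i
    exact i.elim0

lemma Lf_zero (f : ℕ → ℚ) : Lf 0 f = f 0 := by simp [Lf, Pall_zero, mx]
lemma Sf_zero (f : ℕ → ℚ) : Sf 0 f = 0 := by simp [Sf, Pall_zero]
lemma Rf_zero (f : ℕ → ℚ) : Rf 0 f = 0 := by simp [Rf, Pall_zero, srec]

/-- shift -/
def sh (j : ℕ) (f : ℕ → ℚ) : ℕ → ℚ := fun k => f (k + j)

lemma Lf_sh_T (n j : ℕ) (f : ℕ → ℚ) :
    Lf n (sh j (Tf f)) = Lf (n+1) (sh j f) + j * Lf n (sh j f) := by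
  rw [Lf_succ, ← Lf_smul, ← Lf_add]
  congr 1
  funext k
  simp only [sh, Tf]
  rw [show k + 1 + j = k + j + 1 by ring]
  push_cast
  ring

lemma Sf_eq (n : ℕ) (f : ℕ → ℚ) : Sf n f = (n : ℚ) / 2 * (Lf (n+1) f + Lf n f)
    - 1/4 * (Lf (n+2) f - Lf (n+1) f - Lf n (sh 2 f)) := by
  induction n generalizing f with
  | zero =>
    simp only [Sf_zero, Lf_succ, Lf_zero, Tf, sh]
    push_cast
    ring
  | succ n ih =>
    have key : Lf n (fun k => (k : ℚ) * (k+1) / 2 * f k + (k+1) * f (k+1))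
        = 1/2 * Lf (n+2) f + (1/2 * Lf (n+1) f + (-1/2) * Lf n (sh 2 f)) := by
      rw [Lf_succ, Lf_succ, Lf_succ, ← Lf_smul, ← Lf_smul, ← Lf_smul, ← Lf_add, ← Lf_add]
      congr 1
      funext k
      simp only [Tf, sh]
      push_cast
      ring
    rw [Sf_succ, ih, key, Lf_sh_T]
    simp only [← Lf_succ]
    push_cast
    ring

lemma Rf_eq (n : ℕ) (f : ℕ → ℚ) : Rf n f =
    -((n : ℚ) / 2) * (Lf (n+1) (sh 1 f) - Lf n (sh 1 f))
    - 1/4 * (Lf (n+2) (sh 1 f) - Lf (n+1) (sh 1 f)) - 1/12 * Lf n (sh 3 f)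
    + 1/3 * (Lf (n+3) f - 3 * Lf (n+2) f + 2 * Lf (n+1) f)
    - n * Lf n (sh 1 f) - Lf (n+1) (sh 1 f) + Lf (n+2) f - Lf (n+1) f := by
  induction n generalizing f with
  | zero =>
    simp only [Rf_zero, Lf_succ, Lf_zero, Tf, sh]
    push_cast
    ring
  | succ n ih =>
    have h3 : sh 2 (fun k => f (k+1)) = sh 3 f := rfl
    have h1 : (fun k => f (k+1)) = sh 1 f := rfl
    rw [Rf_succ, ih, Sf_eq, h3, h1]
    simp only [Lf_sh_T, ← Lf_succ]
    push_cast
    ring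

lemma stirling2_eq_zero (n k : ℕ) (h : n < k) : stirling2 n k = 0 := by
  induction n generalizing k with
  | zero => cases k with
    | zero => omega
    | succ k => rfl
  | succ n ih => cases k with
    | zero => omega
    | succ k => rw [stirling2, ih k (by omega), ih (k+1) (by omega)]; simp

lemma Lf_stirling (n : ℕ) (f : ℕ → ℚ) :
    Lf n f = ∑ k ∈ Finset.range (n+1), (stirling2 n k : ℚ) * f k := by
  induction n generalizing f with
  | zero => simp [Lf_zero, stirling2]
  | succ n ih =>
    rw [Lf_succ, ih, Finset.sum_range_succ' (n := n + 1)]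
    simp only [stirling2, Tf]
    have e : ∑ k ∈ Finset.range (n+1), (stirling2 n k : ℚ) * (k * f k)
        = ∑ k ∈ Finset.range (n+1), (stirling2 n (k+1) : ℚ) * ((k+1 : ℕ) * f (k+1)) := by
      rw [Finset.sum_range_succ' , Finset.sum_range_succ (n := n), stirling2_eq_zero n (n+1) (by omega)]
      simp
    simp only [mul_add, Finset.sum_add_distrib]
    rw [e, ← Finset.sum_add_distrib]
    simp only [Nat.cast_zero, zero_mul, add_zero]
    apply Finset.sum_congr rfl
    intro k _
    push_cast
    ring

lemma Lf_one (n : ℕ) : Lf n (fun _ => 1) = bell n := by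
  rw [Lf_stirling, bell]
  simp

/-- For every `n ≥ 0`, the total value of `srec` over all set
partitions of `[n]` equals
`(1/3)B_{n+3} - (1/4)B_{n+2} - (n/2 + 13/12)B_{n+1} - (1/12 + n/2)B_n`. -/
theorem sum_elements_record_total_bell (n : ℕ) :
    (∑ π ∈ Pall n, srec π : ℚ) =
      (1/3) * bell (n+3) - (1/4) * bell (n+2) -
        ((n : ℚ)/2 + 13/12) * bell (n+1) - (1/12 + (n : ℚ)/2) * bell n := by
  have h := Rf_eq n (fun _ => 1)
  have hs : ∀ j, sh j (fun _ => 1) = fun _ => 1 := fun _ => rfl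
  simp only [hs, Lf_one] at h
  have hR : Rf n (fun _ => 1) = ∑ π ∈ Pall n, (srec π : ℚ) := by simp [Rf]
  rw [← hR, h]
  ring
end

section
/- In the ring of formal power series ℚ[[x]], exp(3x) · exp(exp(x) − 1) = Σ_{n≥0} (B_{n+3} − 3B_{n+2} + 2B_{n+1}) x^n/n!, where exp(cx) denotes the formal power series Σ_{n≥0} c^n x^n/n!. -/
open Finset PowerSeries

theorem aux_expc_one : expc 1 = PowerSeries.exp ℚ := by
  ext n; simp [expc, PowerSeries.coeff_exp]

theorem aux_expc_three : expc 3 = expc 1 ^ 3 := by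
  rw [aux_expc_one, PowerSeries.exp_pow_eq_rescale_exp]
  ext n; simp [expc, PowerSeries.coeff_exp, PowerSeries.coeff_rescale, div_eq_mul_inv]

theorem aux_deriv_expc : d⁄dX ℚ (expc 1) = expc 1 := by
  ext n
  rw [PowerSeries.coeff_derivative]
  simp only [expc, PowerSeries.coeff_mk, one_pow, Nat.factorial_succ]
  push_cast
  field_simp

theorem aux_const : PowerSeries.constantCoeff (expc 1 - 1) = 0 := by
  rw [← PowerSeries.coeff_zero_eq_constantCoeff_apply]
  simp [expc]

theorem aux_deriv_pow (m : ℕ) : d⁄dX ℚ ((expc 1 - 1) ^ (m + 1))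
    = ((m + 1 : ℕ) : ℚ) • ((expc 1 - 1) ^ m * expc 1) := by
  rw [Derivation.leibniz_pow, map_sub, aux_deriv_expc, Derivation.map_one_eq_zero]
  simp [Algebra.smul_def]

theorem aux_stirling (n : ℕ) : ∀ m : ℕ,
    PowerSeries.coeff n ((expc 1 - 1) ^ m) / m.factorial = (stirling2 n m : ℚ) / n.factorial := by
  induction n with
  | zero =>
    intro m
    rw [PowerSeries.coeff_zero_eq_constantCoeff_apply, map_pow, aux_const]
    cases m <;> simp [stirling2]
  | succ n ih =>
    intro m
    cases m with
    | zero => simp [stirling2, PowerSeries.coeff_one]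
    | succ m =>
      have h := congrArg (PowerSeries.coeff n) (aux_deriv_pow m)
      have h2 : (expc 1 - 1) ^ m * expc 1 = (expc 1 - 1) ^ (m+1) + (expc 1 - 1) ^ m := by ring
      rw [PowerSeries.coeff_derivative, h2] at h
      simp only [map_smul, map_add, smul_eq_mul] at h
      have i1 := ih m
      have i2 := ih (m+1)
      simp only [stirling2, Nat.factorial_succ] at *
      push_cast at *
      have hm : (m.factorial : ℚ) ≠ 0 := by positivity
      have hn : (n.factorial : ℚ) ≠ 0 := by positivity
      have hm' : (m : ℚ) + 1 ≠ 0 := by positivity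
      have hn' : (n : ℚ) + 1 ≠ 0 := by positivity
      field_simp at i1 i2 ⊢
      linear_combination (n.factorial : ℚ) * h + (m+1) * i1 + (m+1) * i2

theorem aux_coeff_psExp (n : ℕ) :
    PowerSeries.coeff n (psExp (expc 1 - 1)) = (bell n : ℚ) / n.factorial := by
  simp only [psExp, PowerSeries.coeff_mk, bell, aux_stirling]
  push_cast
  rw [Finset.sum_div]

theorem aux_trunc (N n : ℕ) (h : n < N) :
    PowerSeries.coeff n (psExp (expc 1 - 1)) =
    PowerSeries.coeff n (∑ m ∈ Finset.range N, ((m.factorial : ℚ)⁻¹) • (expc 1 - 1) ^ m) := by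
  simp only [psExp, PowerSeries.coeff_mk, map_sum, map_smul, smul_eq_mul]
  rw [← Finset.sum_subset (Finset.range_mono (Nat.succ_le_of_lt h))]
  · exact Finset.sum_congr rfl fun m _ => by rw [div_eq_inv_mul]
  · intro m _ hm
    have hm : n < m := by simpa using hm
    rw [PowerSeries.coeff_of_lt_order, mul_zero]
    refine lt_of_lt_of_le (by exact_mod_cast hm)
      (PowerSeries.le_order_pow_of_constantCoeff_eq_zero m aux_const)

theorem aux_deriv_psExp :
    d⁄dX ℚ (psExp (expc 1 - 1)) = expc 1 * psExp (expc 1 - 1) := by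
  ext n
  have h1 : PowerSeries.coeff n (expc 1 * psExp (expc 1 - 1)) = PowerSeries.coeff n
      (expc 1 * ∑ m ∈ Finset.range (n+1), ((m.factorial : ℚ)⁻¹) • (expc 1 - 1) ^ m) := by
    rw [PowerSeries.coeff_mul, PowerSeries.coeff_mul]
    refine Finset.sum_congr rfl fun p hp => ?_
    rw [aux_trunc (n+1) p.2]
    have := Finset.HasAntidiagonal.mem_antidiagonal.mp hp
    omega
  rw [h1, PowerSeries.coeff_derivative, aux_trunc (n+2) (n+1) (by omega),
    ← PowerSeries.coeff_derivative]
  congr 1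
  rw [Finset.sum_range_succ', map_add, map_sum, Finset.mul_sum]
  simp only [Derivation.map_smul, aux_deriv_pow, pow_zero, Derivation.map_one_eq_zero,
    smul_zero, add_zero]
  refine Finset.sum_congr rfl fun m _ => ?_
  rw [smul_smul, mul_smul_comm, mul_comm (expc 1)]
  congr 1
  rw [Nat.factorial_succ]
  push_cast
  field_simp

/-- In `ℚ[[x]]`,
`e^{3x} exp(eˣ - 1) = Σ_{n≥0} (B_{n+3} - 3B_{n+2} + 2B_{n+1}) xⁿ/n!`,
where `expc c = Σ_{n≥0} cⁿxⁿ/n!` and `psExp (expc 1 - 1) = exp(exp(x)-1)`. -/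
theorem bell_egf_e3x :
    expc 3 * psExp (expc 1 - 1) =
      PowerSeries.mk (fun n =>
        ((bell (n+3) : ℚ) - 3 * (bell (n+2) : ℚ) + 2 * (bell (n+1) : ℚ)) / n.factorial) := by
  have d1 := aux_deriv_psExp
  have e1 := aux_deriv_expc
  have c := aux_coeff_psExp
  rw [aux_expc_three]
  generalize psExp (expc 1 - 1) = F at *
  generalize expc 1 = E at *
  have d2 : d⁄dX ℚ (d⁄dX ℚ F) = E * F + E ^ 2 * F := by
    rw [d1, Derivation.leibniz, d1, e1]; simp only [smul_eq_mul]; ring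
  have d3 : d⁄dX ℚ (d⁄dX ℚ (d⁄dX ℚ F)) = E * F + 3 * (E ^ 2 * F) + E ^ 3 * F := by
    rw [d2, map_add, Derivation.leibniz, Derivation.leibniz, Derivation.leibniz_pow, d1, e1]
    simp only [smul_eq_mul, nsmul_eq_mul]; push_cast; ring
  have key : E ^ 3 * F = d⁄dX ℚ (d⁄dX ℚ (d⁄dX ℚ F)) - (3:ℚ) • d⁄dX ℚ (d⁄dX ℚ F)
      + (2:ℚ) • d⁄dX ℚ F := by
    rw [d3, d2, d1]; simp only [ofNat_smul_eq_nsmul, nsmul_eq_mul]; push_cast; ring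
  rw [key]
  ext n
  simp only [map_add, map_sub, map_smul, smul_eq_mul, PowerSeries.coeff_derivative, c,
    PowerSeries.coeff_mk, Nat.factorial_succ]
  push_cast
  field_simp
  ring
end
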